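/- Let a,b,c,t,r ∈ ℤ with D := b² − 4ac > 0 and t² − D·r² = 4. Then t + b·r and t − b·r are both even, the matrix M = ((t+br)/2, c·r; −a·r, (t−br)/2) has determinant 1 (hence M ∈ SL₂(ℤ)), and M stabilizes Q = [a,b,c]: Q∘M = Q, i.e. Q( ((t+br)/2)·x + c·r·y , −a·r·x + ((t−br)/2)·y ) = Q(x,y) for all x,y ∈ ℤ. -/

import Mathlib

/-- let `a,b,c,t,r ∈ ℤ` with `D = b² − 4ac > 0` and `t² − D r² = 4`. Then
`t + br` and `t − br` are even, the matrix `M = ((t+br)/2, cr; −ar, (t−br)/2)` has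
determinant `1` (so `M ∈ SL₂(ℤ)`), and `M` stabilizes the form `Q = [a,b,c]`:
`Q(((t+br)/2)x + cr·y, −ar·x + ((t−br)/2)y) = Q(x,y)` for all `x,y ∈ ℤ`. -/
theorem stmt_13 (a b c t r : ℤ) (hD : 0 < b ^ 2 - 4 * a * c)
    (hPell : t ^ 2 - (b ^ 2 - 4 * a * c) * r ^ 2 = 4) :
    Even (t + b * r) ∧ Even (t - b * r) ∧
    ((t + b * r) / 2) * ((t - b * r) / 2) - (c * r) * (-(a * r)) = 1 ∧
    ∀ x y : ℤ,
      a * (((t + b * r) / 2) * x + c * r * y) ^ 2 +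
          b * ((((t + b * r) / 2) * x + c * r * y) *
            (-(a * r) * x + ((t - b * r) / 2) * y)) +
          c * (-(a * r) * x + ((t - b * r) / 2) * y) ^ 2 =
        a * x ^ 2 + b * x * y + c * y ^ 2 := by
  have hprod : (t + b * r) * (t - b * r) = 2 * (2 - 2 * (a * c * r ^ 2)) := by
    linear_combination hPell
  have hplus : Even (t + b * r) := by
    have h : Even ((t + b * r) * (t - b * r)) := hprod ▸ even_two_mul _
    rcases Int.even_mul.mp h with h | h
    · exact h
    · have := h.add (even_two_mul (b * r))
      rwa [show t - b * r + 2 * (b * r) = t + b * r by ring] at this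
  have hminus : Even (t - b * r) := by
    have := hplus.sub (even_two_mul (b * r))
    rwa [show t + b * r - 2 * (b * r) = t - b * r by ring] at this
  refine ⟨hplus, hminus, ?_⟩
  have hp := Int.two_mul_ediv_two_of_even hplus
  have hs := Int.two_mul_ediv_two_of_even hminus
  generalize (t + b * r) / 2 = p at hp ⊢
  generalize (t - b * r) / 2 = s at hs ⊢
  obtain rfl : p = s + b * r := by linarith
  have hdet : (s + b * r) * s - c * r * -(a * r) = 1 := by
    rw [← hp, ← hs] at hprod
    linarith
  refine ⟨hdet, fun x y => ?_⟩
  linear_combination (a * x ^ 2 + b * x * y + c * y ^ 2) * hdet
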